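/- Fix integers m ≥ 1, n ≥ 1 and reals ν > m−1, σ² > 0, ρ² > 0, and fix x_1,…,x_{n−1} ∈ ℝ^m. Then ∫_{ℝ^m} |Σ̄_n|^{−(ν+n)/2} dx_n = [π^{m/2}·Γ((ν+n−m)/2) / ( (((ν+n−1)/(ν+n))·c_{n−1})^{m/2} · Γ((ν+n)/2) )] · |((ν+n−1)/(ν+n))·Σ̄_{n−1}|^{−(ν+n−1)/2}, where c_k = (ρ²ν+k)/((ν+k)(ρ²ν+k+1)), Σ̄_n is the MAP covariance estimate from x_1,…,x_n (viewed as a function of x_n), and Σ̄_{n−1} is the MAP covariance estimate from x_1,…,x_{n−1}. -/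

import Mathlib

open MeasureTheory Matrix Real BigOperators

/-- Likelihood of `n` observations under the `m`-dimensional normal distribution
with mean `μ` and covariance `S`. -/
noncomputable def mvnLik (m n : ℕ) (x : Fin n → Fin m → ℝ) (μ : Fin m → ℝ)
    (S : Matrix (Fin m) (Fin m) ℝ) : ℝ :=
  ∏ i : Fin n, (2 * π) ^ (-(m : ℝ) / 2) * S.det ^ (-(1 : ℝ) / 2) *
    Real.exp (-(1 / 2) * ((x i - μ) ⬝ᵥ (S⁻¹ *ᵥ (x i - μ))))

/-- The simple luckiness function `π(μ, Σ; ν, σ², ρ²)`. -/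
noncomputable def luck (m : ℕ) (μ : Fin m → ℝ) (S : Matrix (Fin m) (Fin m) ℝ)
    (ν σ2 ρ2 : ℝ) : ℝ :=
  (2 * π) ^ (-(m : ℝ) * ν / 2) * S.det ^ (-ν / 2) *
    Real.exp (-(ν / 2) *
      (S⁻¹ * (σ2 • (1 : Matrix (Fin m) (Fin m) ℝ) + ρ2 • vecMulVec μ μ)).trace)

/-- The generalized luckiness function `π(μ, Σ; ν, μ₀, Σ₀, ρ²)`. -/
noncomputable def luck2 (m : ℕ) (μ : Fin m → ℝ) (S : Matrix (Fin m) (Fin m) ℝ)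
    (ν : ℝ) (μ0 : Fin m → ℝ) (S0 : Matrix (Fin m) (Fin m) ℝ) (ρ2 : ℝ) : ℝ :=
  (2 * π) ^ (-(m : ℝ) * ν / 2) * S.det ^ (-ν / 2) *
    Real.exp (-(ν / 2) *
      (S⁻¹ * (S0 + ρ2 • vecMulVec (μ - μ0) (μ - μ0))).trace)

/-- MAP location estimate `μ̄_k` for the simple luckiness. -/
noncomputable def muBar (m k : ℕ) (ν ρ2 : ℝ) (x : Fin k → Fin m → ℝ) : Fin m → ℝ :=
  (1 / (k + ρ2 * ν)) • ∑ i : Fin k, x i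

/-- MAP covariance estimate `Σ̄_k` for the simple luckiness. -/
noncomputable def sigmaBar (m k : ℕ) (ν σ2 ρ2 : ℝ) (x : Fin k → Fin m → ℝ) :
    Matrix (Fin m) (Fin m) ℝ :=
  (1 / (k + ν)) •
      (∑ i : Fin k, vecMulVec (x i) (x i) + (ν * σ2) • (1 : Matrix (Fin m) (Fin m) ℝ))
    - (1 / ((ν + k) * (ρ2 * ν + k))) • ∑ i : Fin k, ∑ j : Fin k, vecMulVec (x i) (x j)

/-- MAP location estimate `μ̄_k` for the generalized luckiness. -/
noncomputable def muBar2 (m k : ℕ) (ν ρ2 : ℝ) (μ0 : Fin m → ℝ)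
    (x : Fin k → Fin m → ℝ) : Fin m → ℝ :=
  μ0 + (1 / (k + ρ2 * ν)) • ∑ i : Fin k, (x i - μ0)

/-- MAP covariance estimate `Σ̄_k` for the generalized luckiness. -/
noncomputable def sigmaBar2 (m k : ℕ) (ν ρ2 : ℝ) (μ0 : Fin m → ℝ)
    (S0 : Matrix (Fin m) (Fin m) ℝ) (x : Fin k → Fin m → ℝ) : Matrix (Fin m) (Fin m) ℝ :=
  (1 / (k + ν)) • (∑ i : Fin k, vecMulVec (x i - μ0) (x i - μ0) + ν • S0)
    - (1 / ((ν + k) * (ρ2 * ν + k))) •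
        ∑ i : Fin k, ∑ j : Fin k, vecMulVec (x i - μ0) (x j - μ0)

/-- The multivariate gamma function `Γ_m(z)`. -/
noncomputable def multiGamma (m : ℕ) (z : ℝ) : ℝ :=
  π ^ ((m : ℝ) * ((m : ℝ) - 1) / 4) * ∏ j : Fin m, Real.Gamma (z - (j : ℝ) / 2)

/-- The capacity `𝒞(m, n, ν, σ², ρ²)` (note: the fourth argument is `σ²`,
so `σ^{-mν} = (σ²)^{-mν/2}`). -/
noncomputable def capC (m n : ℕ) (ν σ2 ρ2 : ℝ) : ℝ :=
  σ2 ^ (-(m : ℝ) * ν / 2) *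
    ((((n : ℝ) + ν) ^ ((n : ℝ) + ν) * (1 + n / (ρ2 * ν))) /
        ((2 * Real.exp 1) ^ ((n : ℝ) + ν) * (π * ν) ^ ν)) ^ ((m : ℝ) / 2) *
    (multiGamma m (ν / 2) / multiGamma m (((n : ℝ) + ν) / 2))

/-- The pointwise supremum of likelihood times simple luckiness over all `μ`
and positive definite `Σ`. -/
noncomputable def supLik (m n : ℕ) (ν σ2 ρ2 : ℝ) (x : Fin n → Fin m → ℝ) : ℝ :=
  ⨆ p : (Fin m → ℝ) × {S : Matrix (Fin m) (Fin m) ℝ // S.PosDef},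
    mvnLik m n x p.1 p.2.1 * luck m p.1 p.2.1 ν σ2 ρ2

/-- The pointwise supremum of likelihood times generalized luckiness over all `μ`
and positive definite `Σ`. -/
noncomputable def supLik2 (m n : ℕ) (ν : ℝ) (μ0 : Fin m → ℝ)
    (S0 : Matrix (Fin m) (Fin m) ℝ) (ρ2 : ℝ) (x : Fin n → Fin m → ℝ) : ℝ :=
  ⨆ p : (Fin m → ℝ) × {S : Matrix (Fin m) (Fin m) ℝ // S.PosDef},
    mvnLik m n x p.1 p.2.1 * luck2 m p.1 p.2.1 ν μ0 S0 ρ2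

/-- The density of the `m`-variate Student t-distribution with `d` degrees of
freedom, location `μ` and scale matrix `S`. -/
noncomputable def tDens (m : ℕ) (d : ℝ) (x μ : Fin m → ℝ)
    (S : Matrix (Fin m) (Fin m) ℝ) : ℝ :=
  Real.Gamma ((d + m) / 2) /
      (Real.Gamma (d / 2) * (d * π) ^ ((m : ℝ) / 2) * S.det ^ ((1 : ℝ) / 2)) *
    (1 + (1 / d) * ((x - μ) ⬝ᵥ (S⁻¹ *ᵥ (x - μ)))) ^ (-(d + (m : ℝ)) / 2)

/-- The normalizing integral of the standard multivariate Student (Cauchy type) density. -/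
theorem integral_one_add_sum_sq_rpow_neg {ι : Type*} [Fintype ι] {s : ℝ}
    (hs : (Fintype.card ι : ℝ) / 2 < s) :
    ∫ u : ι → ℝ, (1 + ∑ i, u i ^ 2) ^ (-s)
      = π ^ ((Fintype.card ι : ℝ) / 2) * Real.Gamma (s - Fintype.card ι / 2) / Real.Gamma s := by
  set d : ℝ := (Fintype.card ι : ℝ) with hd
  have hd0 : 0 ≤ d := Nat.cast_nonneg _
  have hs0 : 0 < s := by linarith
  let F : (ι → ℝ) → ℝ → ℝ := fun u t => t ^ (s - 1) * Real.exp (-((1 + ∑ i, u i ^ 2) * t))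
  have hF (u : ι → ℝ) (t : ℝ) :
      F u t = t ^ (s - 1) * Real.exp (-t) * ∏ i, Real.exp (-t * u i ^ 2) := by
    rw [← Real.exp_sum, mul_assoc, ← Real.exp_add, ← Finset.mul_sum]
    simp only [F]
    ring_nf
  have hint (t : ℝ) (ht : 0 < t) : Integrable (fun u : ι → ℝ => F u t) := by
    simp only [hF]
    exact (Integrable.fintype_prod (f := fun _ x => Real.exp (-t * x ^ 2))
      fun _ => integrable_exp_neg_mul_sq ht).const_mul _
  have hu (t : ℝ) (ht : 0 < t) :
      ∫ u : ι → ℝ, F u t = π ^ (d / 2) * (t ^ (s - d / 2 - 1) * Real.exp (-(1 * t))) := by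
    simp only [hF]
    rw [integral_const_mul, integral_fintype_prod_volume_eq_pow (fun x => Real.exp (-t * x ^ 2)),
      integral_gaussian, Real.sqrt_eq_rpow, ← Real.rpow_natCast, ← Real.rpow_mul (by positivity),
      ← hd, Real.div_rpow (by positivity) ht.le, show s - d / 2 - 1 = (s - 1) - 1 / 2 * d by ring,
      Real.rpow_sub ht (s - 1), one_mul, show d / 2 = 1 / 2 * d by ring]
    ring
  have ht (u : ι → ℝ) :
      ∫ t in Set.Ioi 0, F u t = (1 + ∑ i, u i ^ 2) ^ (-s) * Real.Gamma s := by
    have h : 0 < 1 + ∑ i, u i ^ 2 := by positivity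
    rw [Real.integral_rpow_mul_exp_neg_mul_Ioi hs0 h, one_div, Real.inv_rpow h.le,
      Real.rpow_neg h.le]
  have hprod : Integrable (Function.uncurry F) (volume.prod (volume.restrict (Set.Ioi 0))) := by
    rw [integrable_prod_iff']
    · constructor
      · filter_upwards [ae_restrict_mem measurableSet_Ioi] with t ht using hint t ht
      · have hG : IntegrableOn (fun t : ℝ => π ^ (d / 2) *
            (t ^ (s - d / 2 - 1) * Real.exp (-(1 * t)))) (Set.Ioi 0) := by
          refine Integrable.const_mul ?_ _
          have := Real.GammaIntegral_convergent (s := s - d / 2) (by linarith)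
          simpa only [IntegrableOn, one_mul, mul_comm (Real.exp _)] using this
        refine hG.congr ?_
        filter_upwards [ae_restrict_mem measurableSet_Ioi] with t ht
        rw [← hu t ht]
        refine integral_congr_ae (ae_of_all _ fun u => ?_)
        have : 0 ≤ F u t := mul_nonneg (Real.rpow_nonneg (le_of_lt ht) _) (Real.exp_nonneg _)
        simp [Function.uncurry, abs_of_nonneg this]
    · refine Measurable.aestronglyMeasurable ?_
      simp only [Function.uncurry_def, F]
      fun_prop
  have hswap := integral_integral_swap hprod
  simp only [ht] at hswap
  rw [integral_mul_const, setIntegral_congr_fun measurableSet_Ioi (fun t ht => hu t ht),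
    integral_const_mul, Real.integral_rpow_mul_exp_neg_mul_Ioi (by linarith) one_pos] at hswap
  rw [eq_div_iff (Real.Gamma_pos_of_pos hs0).ne', hswap]
  simp

/-- Linear change of variables by an invertible matrix. -/
theorem integral_eq_abs_det_mul_integral_mulVec {ι : Type*} [Fintype ι] [DecidableEq ι]
    {M : Matrix ι ι ℝ} (hM : M.det ≠ 0) (f : (ι → ℝ) → ℝ) :
    ∫ v, f v = |M.det| * ∫ u, f (M *ᵥ u) := by
  have hinj : Function.Injective (toLin' M) := by
    exact Matrix.mulVec_injective_iff_isUnit.2 ((Matrix.isUnit_iff_isUnit_det M).2 hM.isUnit)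
  have hemb : MeasurableEmbedding (toLin' M) :=
    (LinearMap.isClosedEmbedding_of_injective (LinearMap.ker_eq_bot.2 hinj)).measurableEmbedding
  have h := hemb.integral_map (μ := volume) f
  rw [Real.map_matrix_volume_pi_eq_smul_volume_pi hM, integral_smul_measure,
    ENNReal.toReal_ofReal (abs_nonneg _), abs_inv, smul_eq_mul] at h
  simp only [toLin'_apply] at h
  rw [← h, mul_inv_cancel_left₀ (abs_ne_zero.2 hM)]

open scoped MatrixOrder in
/-- Integral of a power of the determinant of a rank-one update. -/
theorem integral_det_add_smul_vecMulVec_rpow_neg {ι : Type*} [Fintype ι] [DecidableEq ι]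
    {A : Matrix ι ι ℝ} (hA : A.PosDef) {k s : ℝ} (hk : 0 < k)
    (hs : (Fintype.card ι : ℝ) / 2 < s) (μ : ι → ℝ) :
    ∫ y : ι → ℝ, (A + k • vecMulVec (y - μ) (y - μ)).det ^ (-s)
      = π ^ ((Fintype.card ι : ℝ) / 2) * Real.Gamma (s - Fintype.card ι / 2) /
          (k ^ ((Fintype.card ι : ℝ) / 2) * Real.Gamma s) * A.det ^ (1 / 2 - s) := by
  rw [integral_sub_right_eq_self (fun v => (A + k • vecMulVec v v).det ^ (-s)) μ]
  obtain ⟨B, hB⟩ := CStarAlgebra.nonneg_iff_eq_star_mul_self.1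
    (Matrix.nonneg_iff_posSemidef.2 hA.posSemidef)
  have hAdet : A.det = B.det ^ 2 := by
    rw [hB, det_mul, Matrix.star_eq_conjTranspose, det_conjTranspose]
    simp [sq]
  have hB0 : B.det ≠ 0 := by
    intro h
    exact hA.det_pos.ne' (by simp [hAdet, h])
  set d : ℝ := (Fintype.card ι : ℝ) with hd
  have hk' : 0 < √k := Real.sqrt_pos.2 hk
  have hdet : ((√k)⁻¹ • Bᵀ).det = (k ^ (d / 2))⁻¹ * B.det := by
    rw [det_smul, det_transpose, inv_pow, Real.sqrt_eq_rpow, ← Real.rpow_natCast,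
      ← Real.rpow_mul hk.le, ← hd, show 1 / 2 * d = d / 2 by ring]
  have hM : ((√k)⁻¹ • Bᵀ).det ≠ 0 := by
    rw [hdet]
    positivity
  have hrank (u : ι → ℝ) :
      (A + k • vecMulVec (((√k)⁻¹ • Bᵀ) *ᵥ u) (((√k)⁻¹ • Bᵀ) *ᵥ u)).det
        = A.det * (1 + ∑ i, u i ^ 2) := by
    have hfac : A + k • vecMulVec (((√k)⁻¹ • Bᵀ) *ᵥ u) (((√k)⁻¹ • Bᵀ) *ᵥ u)
        = Bᵀ * (1 + vecMulVec u u) * B := by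
      rw [mul_add, add_mul, mul_one, mul_vecMulVec, vecMulVec_mul, smul_mulVec,
        smul_vecMulVec, vecMulVec_smul, smul_smul, smul_smul, mul_assoc, ← mul_inv,
        Real.mul_self_sqrt hk.le, mul_inv_cancel₀ hk.ne', one_smul, hB, mulVec_transpose]
      simp [star_eq_conjTranspose]
    rw [hfac, det_mul, det_mul, det_transpose, vecMulVec_eq Unit,
      det_one_add_replicateCol_mul_replicateRow, hAdet]
    simp only [dotProduct, ← sq]
    ring
  rw [integral_eq_abs_det_mul_integral_mulVec hM]
  simp only [hrank]
  have hmul (u : ι → ℝ) : (A.det * (1 + ∑ i, u i ^ 2)) ^ (-s)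
      = A.det ^ (-s) * (1 + ∑ i, u i ^ 2) ^ (-s) :=
    Real.mul_rpow hA.det_pos.le (by positivity)
  have habs : |B.det| = A.det ^ (1 / 2 : ℝ) := by
    rw [hAdet, ← Real.sqrt_eq_rpow, Real.sqrt_sq_eq_abs]
  simp only [hmul]
  rw [integral_const_mul, integral_one_add_sum_sq_rpow_neg hs, hdet, abs_mul, habs,
    abs_of_pos (by positivity), sub_eq_add_neg (1 / 2 : ℝ), Real.rpow_add hA.det_pos, ← hd]
  field_simp

theorem sigmaBar_posDef (m k : ℕ) {ν σ2 ρ2 : ℝ} (hν : 0 < ν) (hσ : 0 < σ2) (hρ : 0 < ρ2)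
    (x : Fin k → Fin m → ℝ) : (sigmaBar m k ν σ2 ρ2 x).PosDef := by
  rw [posDef_iff_dotProduct_mulVec]
  have hp : 0 < ρ2 * ν := mul_pos hρ hν
  refine ⟨?_, fun w hw => ?_⟩
  · rw [Matrix.IsHermitian, conjTranspose_eq_transpose_of_trivial]
    ext a b
    simp only [sigmaBar, transpose_apply, Matrix.sub_apply, Matrix.add_apply, Matrix.smul_apply,
      Matrix.sum_apply, vecMulVec_apply, Matrix.one_apply, eq_comm (a := a), smul_eq_mul,
      ← Finset.mul_sum, ← Finset.sum_mul]
    simp only [mul_comm]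
  · have hform : star w ⬝ᵥ (sigmaBar m k ν σ2 ρ2 x *ᵥ w)
        = 1 / (k + ν) * (∑ i, (x i ⬝ᵥ w) ^ 2 + ν * σ2 * (w ⬝ᵥ w))
          - 1 / ((ν + k) * (ρ2 * ν + k)) * (∑ i, x i ⬝ᵥ w) ^ 2 := by
      simp only [sigmaBar, star_trivial, sub_mulVec, add_mulVec, smul_mulVec, sum_mulVec,
        one_mulVec, vecMulVec_mulVec, sub_dotProduct, add_dotProduct, smul_dotProduct,
        sum_dotProduct, smul_eq_mul, op_smul_eq_smul, dotProduct_comm w, sq, Finset.sum_mul_sum]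
      simp only [mul_comm]
    have hww : 0 < w ⬝ᵥ w := by
      simpa using (dotProduct_star_self_pos_iff (v := w)).2 hw
    have hcs : (∑ i, x i ⬝ᵥ w) ^ 2 ≤ (ρ2 * ν + k) * ∑ i, (x i ⬝ᵥ w) ^ 2 := by
      have h := sq_sum_le_card_mul_sum_sq (s := Finset.univ) (f := fun i => x i ⬝ᵥ w)
      have h' : 0 ≤ ρ2 * ν * ∑ i, (x i ⬝ᵥ w) ^ 2 := by positivity
      simp only [Finset.card_univ, Fintype.card_fin] at h
      linarith
    have hid : star w ⬝ᵥ (sigmaBar m k ν σ2 ρ2 x *ᵥ w) =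
        (((ρ2 * ν + k) * ∑ i, (x i ⬝ᵥ w) ^ 2 - (∑ i, x i ⬝ᵥ w) ^ 2) / (ρ2 * ν + k)
          + ν * σ2 * (w ⬝ᵥ w)) / (ν + k) := by
      rw [hform, add_comm (k : ℝ) ν]
      field_simp
      ring
    rw [hid]
    have := sub_nonneg.2 hcs
    positivity

/-- Appending an observation is a scaled rank-one update of the covariance estimate. -/
theorem sigmaBar_snoc (m k : ℕ) {ν σ2 ρ2 : ℝ} (hν : 0 < ν) (hρ : 0 < ρ2)
    (x : Fin k → Fin m → ℝ) (y : Fin m → ℝ) :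
    sigmaBar m (k + 1) ν σ2 ρ2 (Fin.snoc x y) =
      ((ν + k) / (ν + k + 1)) • sigmaBar m k ν σ2 ρ2 x +
        (((ν + k) / (ν + k + 1)) * ((ρ2 * ν + k) / ((ν + k) * (ρ2 * ν + k + 1)))) •
          vecMulVec (y - muBar m k ν ρ2 x) (y - muBar m k ν ρ2 x) := by
  ext a b
  have hp : 0 < ρ2 * ν := mul_pos hρ hν
  simp only [sigmaBar, muBar, Fin.sum_univ_castSucc, Fin.snoc_castSucc, Fin.snoc_last,
    Matrix.sub_apply, Matrix.add_apply, Matrix.smul_apply, Matrix.sum_apply, vecMulVec_apply,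
    smul_eq_mul, Pi.sub_apply, Pi.smul_apply, Finset.sum_apply, Finset.sum_add_distrib,
    ← Finset.mul_sum, ← Finset.sum_mul]
  push_cast
  generalize ∑ i, x i a = Sa
  generalize ∑ i, x i b = Sb
  generalize ∑ i, x i a * x i b = T
  have h1 : ν + k ≠ 0 := by positivity
  have h2 : ν + k + 1 ≠ 0 := by positivity
  have h3 : ρ2 * ν + k ≠ 0 := by positivity
  have h4 : ρ2 * ν + k + 1 ≠ 0 := by positivity
  rw [show (k : ℝ) + 1 + ν = ν + k + 1 by ring, show (k : ℝ) + ν = ν + k by ring,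
    show (k : ℝ) + ρ2 * ν = ρ2 * ν + k by ring, ← add_assoc, ← add_assoc]
  generalize (1 : Matrix (Fin m) (Fin m) ℝ) a b = e
  field_simp
  ring

/-- the one-step marginalization integral over the last observation,
with `c_{n-1} = (ρ²ν+n-1)/((ν+n-1)(ρ²ν+n))`. -/
theorem sigmaBar_det_integral_step (m n : ℕ) (hm : 1 ≤ m) (hn : 1 ≤ n) (ν σ2 ρ2 : ℝ)
    (hν : (m : ℝ) - 1 < ν) (hσ : 0 < σ2) (hρ : 0 < ρ2)
    (x : Fin (n - 1) → Fin m → ℝ) :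
    ∫ y : Fin m → ℝ,
        (sigmaBar m n ν σ2 ρ2
            (fun i => if h : (i : ℕ) < n - 1 then x ⟨i, h⟩ else y)).det ^ (-(ν + n) / 2)
      = π ^ ((m : ℝ) / 2) * Real.Gamma ((ν + n - m) / 2) /
          ((((ν + n - 1) / (ν + n)) *
              ((ρ2 * ν + n - 1) / ((ν + n - 1) * (ρ2 * ν + n)))) ^ ((m : ℝ) / 2) *
            Real.Gamma ((ν + n) / 2)) *
        (((ν + n - 1) / (ν + n)) • sigmaBar m (n - 1) ν σ2 ρ2 x).det ^ (-(ν + n - 1) / 2) := by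
  obtain ⟨k, rfl⟩ : ∃ k, n = k + 1 := ⟨n - 1, by omega⟩
  have hm1 : (1 : ℝ) ≤ m := by exact_mod_cast hm
  have hν0 : 0 < ν := by linarith
  have hp : 0 < ρ2 * ν := mul_pos hρ hν0
  have hk : (0 : ℝ) ≤ k := Nat.cast_nonneg k
  change Fin k → Fin m → ℝ at x
  change ∫ y : Fin m → ℝ, (sigmaBar m (k + 1) ν σ2 ρ2 (fun i : Fin (k + 1) =>
      if h : (i : ℕ) < k then x ⟨i, h⟩ else y)).det ^ (-(ν + (k + 1 : ℕ)) / 2) =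
    _ * (_ • sigmaBar m k ν σ2 ρ2 x).det ^ _
  have hsnoc (y : Fin m → ℝ) :
      (fun i : Fin (k + 1) => if h : (i : ℕ) < k then x ⟨i, h⟩ else y)
        = (Fin.snoc x y : Fin (k + 1) → Fin m → ℝ) := by
    ext i
    simp [Fin.snoc, Fin.castLT]
  have hA := (sigmaBar_posDef m k hν0 hσ hρ x).smul (show 0 < (ν + k) / (ν + k + 1) by positivity)
  have h := integral_det_add_smul_vecMulVec_rpow_neg hA
    (k := ((ν + k) / (ν + k + 1)) * ((ρ2 * ν + k) / ((ν + k) * (ρ2 * ν + k + 1))))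
    (s := (ν + k + 1) / 2) (by positivity)
    (by rw [Fintype.card_fin]; linarith) (muBar m k ν ρ2 x)
  simp only [hsnoc, sigmaBar_snoc m k hν0 hρ]
  rw [Fintype.card_fin] at h
  push_cast
  convert h using 3 <;> ring_nf
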